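/- arXiv:2010.15814 — 15 statements merged into one kernel-verified Lean document; each statement's English description precedes it below -/
import Mathlib

section
/- Let G be a connected finite simple graph and let (u,v) be a dominating pair of G. Then every vertex x of G with eccentricity e(x) ≥ 3 is at distance exactly e(x) from some vertex of N[u] ∪ N[v]; that is, there exists w ∈ N[u] ∪ N[v] with dist(x,w) = e(x). -/
open SimpleGraph

/-- The closed neighbourhood `N[x]` of a vertex `x`. -/
def closedNbhd {V : Type*} (G : SimpleGraph V) (x : V) : Set V :=
  {z | z = x ∨ G.Adj x z}

/-- `(u,v)` is a dominating pair of `G`: every path between `u` and `v`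
contains a vertex of `N[x]`, for every vertex `x`. -/
def DominatingPair {V : Type*} (G : SimpleGraph V) (u v : V) : Prop :=
  ∀ (x : V) (p : G.Walk u v), p.IsPath → ∃ z ∈ p.support, z ∈ closedNbhd G x

/-- The eccentricity of a vertex: the maximum distance to any other vertex. -/
noncomputable def ecc {V : Type*} [Fintype V] (G : SimpleGraph V) (u : V) : ℕ :=
  Finset.univ.sup fun v => G.dist u v

/-- If `(u,v)` is a dominating pair of a connected graph `G`, then every vertex `x`
with eccentricity at least `3` is at distance exactly `e(x)` from some vertex of
`N[u] ∪ N[v]`. -/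
theorem dominating_pair_far_vertex {V : Type*} [Fintype V] (G : SimpleGraph V)
    (hconn : G.Connected) (u v : V) (hdom : DominatingPair G u v)
    (x : V) (hx : 3 ≤ ecc G x) :
    ∃ w ∈ closedNbhd G u ∪ closedNbhd G v, G.dist x w = ecc G x := by
  classical
  have hle : ∀ w, G.dist x w ≤ ecc G x := fun w =>
    Finset.le_sup (f := fun v => G.dist x v) (Finset.mem_univ w)
  obtain ⟨y, -, hy⟩ := Finset.exists_mem_eq_sup Finset.univ ⟨x, Finset.mem_univ x⟩
    (fun v => G.dist x v)
  replace hy : ecc G x = G.dist x y := hy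
  by_cases hu : G.dist x u = ecc G x
  · exact ⟨u, Or.inl (Or.inl rfl), hu⟩
  by_cases hv : G.dist x v = ecc G x
  · exact ⟨v, Or.inr (Or.inl rfl), hv⟩
  have hu' := hle u
  have hv' := hle v
  have key : ∀ a z (p : G.Walk x a), p.length = G.dist x a → z ∈ p.support →
      z ∈ closedNbhd G y → G.dist x a < ecc G x → y ∈ closedNbhd G a := by
    intro a z p hp hz hzy ha
    have h1 : (p.takeUntil z hz).length + (p.dropUntil z hz).length = p.length := by
      rw [← Walk.length_append, Walk.take_spec]
    have h2 := dist_le (p.takeUntil z hz)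
    have h3 := dist_le (p.dropUntil z hz)
    rcases hzy with rfl | hadj
    · omega
    · have h4 := hconn.dist_triangle (u := x) (v := z) (w := y)
      have h5 : G.dist z y = 1 := dist_eq_one_iff_adj.2 hadj.symm
      have h6 : G.dist z a = 0 := by omega
      have h7 : z = a := hconn.dist_eq_zero_iff.1 h6
      subst h7
      exact Or.inr hadj.symm
  obtain ⟨p, hp⟩ := hconn.exists_walk_length_eq_dist x u
  obtain ⟨q, hq⟩ := hconn.exists_walk_length_eq_dist x v
  obtain ⟨z, hz, hzy⟩ := hdom y (p.reverse.append q).bypass (Walk.bypass_isPath _)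
  have hz' := Walk.support_bypass_subset _ hz
  rw [Walk.mem_support_append_iff, Walk.support_reverse, List.mem_reverse] at hz'
  refine ⟨y, ?_, hy.symm⟩
  rcases hz' with h | h
  · exact Or.inl (key u z p hp h hzy (by omega))
  · exact Or.inr (key v z q hq h hzy (by omega))
end

section
/- Let G be a connected AT-free graph on n vertices, let u be a vertex of G, and let σ : {1,…,n} → V be a bijective numbering of the vertices satisfying: (P1) for all vertices y,z, if dist(u,z) < dist(u,y) then σ⁻¹(z) > σ⁻¹(y); and (P2) for every vertex y, the pair (u,y) is a dominating pair of the subgraph of G induced by { z : σ⁻¹(z) ≥ σ⁻¹(y) }. Let x,y be nonadjacent vertices with dist(u,x) = dist(u,y) = i and σ⁻¹(x) < σ⁻¹(y). Then for every vertex z with dist(u,z) < i, one has dist(y,z) ≤ dist(x,z). -/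
open SimpleGraph

/-- `x, y, z` form an asteroidal triple: between any two of them there is a path
avoiding the closed neighbourhood of the third. -/
def IsAT {V : Type*} (G : SimpleGraph V) (x y z : V) : Prop :=
  (∃ p : G.Walk x y, p.IsPath ∧ ∀ w ∈ p.support, w ∉ closedNbhd G z) ∧
  (∃ p : G.Walk y z, p.IsPath ∧ ∀ w ∈ p.support, w ∉ closedNbhd G x) ∧
  (∃ p : G.Walk x z, p.IsPath ∧ ∀ w ∈ p.support, w ∉ closedNbhd G y)

/-- `G` is AT-free if it contains no asteroidal triple. -/
def ATFree {V : Type*} (G : SimpleGraph V) : Prop :=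
  ∀ x y z : V, ¬ IsAT G x y z

/-- In a connected AT-free graph with a numbering `σ` satisfying the LexBFS
properties (P1) and (P2) with respect to `u`: for nonadjacent `x, y` in the same
distance layer `i` from `u` with `σ⁻¹(x) < σ⁻¹(y)`, every vertex `z` with
`dist(u,z) < i` satisfies `dist(y,z) ≤ dist(x,z)`. -/
theorem lexbfs_dom_ecc {V : Type*} [Fintype V] (G : SimpleGraph V)
    (hconn : G.Connected) (hAT : ATFree G)
    (n : ℕ) (hn : n = Fintype.card V) (σ : Fin n ≃ V) (u : V)
    -- (P1): vertices farther from `u` get smaller numbers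
    (hP1 : ∀ y z : V, G.dist u z < G.dist u y → σ.symm y < σ.symm z)
    -- (P2): for every `y`, the pair `(u,y)` is dominating in the subgraph induced by
    -- the vertices numbered at least `σ⁻¹(y)`
    (hP2 : ∀ y x : V, σ.symm y ≤ σ.symm x →
      ∀ p : G.Walk u y, p.IsPath → (∀ w ∈ p.support, σ.symm y ≤ σ.symm w) →
      ∃ z ∈ p.support, z ∈ closedNbhd G x)
    (x y : V) (i : ℕ) (hadj : ¬ G.Adj x y)
    (hx : G.dist u x = i) (hy : G.dist u y = i) (hσ : σ.symm x < σ.symm y) :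
    ∀ z : V, G.dist u z < i → G.dist y z ≤ G.dist x z := by
  classical
  intro z hz
  obtain ⟨p, hp⟩ := hconn.exists_walk_length_eq_dist x z
  obtain ⟨q, hq⟩ := hconn.exists_walk_length_eq_dist z u
  have split : ∀ {a b : V} (r : G.Walk a b), r.length = G.dist a b →
      ∀ v ∈ r.support, G.dist a v + G.dist v b ≤ G.dist a b := by
    intro a b r hr v hv
    have h1 := congrArg Walk.length (r.take_spec hv)
    rw [Walk.length_append] at h1
    have h2 := dist_le (r.takeUntil v hv)
    have h3 := dist_le (r.dropUntil v hv)
    omega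
  obtain ⟨w, hw, hmin⟩ := Finset.exists_min_image (p.append q).support.toFinset σ.symm
    ⟨x, by simp⟩
  simp only [List.mem_toFinset] at hw hmin
  have hwx : σ.symm w ≤ σ.symm x := hmin x (Walk.start_mem_support _)
  let r := ((p.append q).dropUntil w hw).reverse
  have hsub : ∀ v ∈ r.bypass.support, v ∈ (p.append q).support := by
    intro v hv
    have h1 := r.support_bypass_subset hv
    have h2 : v ∈ ((p.append q).dropUntil w hw).support := by
      simpa [r, Walk.support_reverse] using h1
    exact (p.append q).support_dropUntil_subset hw h2
  obtain ⟨v, hv, hvy⟩ := hP2 w y (hwx.trans hσ.le) r.bypass r.bypass_isPath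
    (fun v hv => hmin v (hsub v hv))
  have hyv : G.dist y v ≤ 1 := by
    rcases hvy with rfl | h
    · simp
    · exact (dist_eq_one_iff_adj.mpr h).le
  have hv' := (Walk.mem_support_append_iff p q).1 (hsub v hv)
  have hvx : v ≠ x := by
    rintro rfl
    rcases hvy with h | h
    · rw [h] at hσ; exact lt_irrefl _ hσ
    · exact hadj h.symm
  have t := hconn.dist_triangle (u := y) (v := v) (w := z)
  rcases hv' with h | h
  · have h1 := split p hp v h
    have h2 := hconn.pos_dist_of_ne hvx.symm
    omega
  · have h1 := split q hq v h
    have h2 := hconn.dist_triangle (u := u) (v := v) (w := y)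
    have h3 : 0 < G.dist x z := hconn.pos_dist_of_ne (by rintro rfl; omega)
    have e1 : G.dist v y = G.dist y v := dist_comm
    have e2 : G.dist v u = G.dist u v := dist_comm
    have e3 : G.dist z u = G.dist u z := dist_comm
    have e4 : G.dist z v = G.dist v z := dist_comm
    omega
end

section
/- Let G be a connected AT-free graph on n vertices, let u be a vertex of G, and let σ : {1,…,n} → V be a bijective numbering of the vertices satisfying: (P1) for all vertices y,z, if dist(u,z) < dist(u,y) then σ⁻¹(z) > σ⁻¹(y); (P2) for every vertex y, the pair (u,y) is a dominating pair of the subgraph of G induced by { z : σ⁻¹(z) ≥ σ⁻¹(y) }; and (P3) for all nonadjacent vertices x,y with dist(u,x) = dist(u,y) = i and σ⁻¹(x) < σ⁻¹(y), one has N(x) ∩ { z : dist(u,z) = i−1 } ⊆ N(y) ∩ { z : dist(u,z) = i−1 }, and in particular dist(x,y) ≤ 2. Suppose G has no universal vertex, and let x,y be nonadjacent vertices with dist(u,x) = dist(u,y) = e(u) and σ⁻¹(x) < σ⁻¹(y). Then e(x) ≥ e(y). -/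
open SimpleGraph

theorem walk_dist_sum {V : Type*} (G : SimpleGraph V) {a b : V}
    (p : G.Walk a b) {w : V} (hw : w ∈ p.support) : G.dist a w + G.dist w b ≤ p.length := by
  classical
  have h := congrArg Walk.length (p.take_spec hw)
  rw [Walk.length_append] at h
  have h1 := SimpleGraph.dist_le (p.takeUntil w hw)
  have h2 := SimpleGraph.dist_le (p.dropUntil w hw)
  omega

theorem dist_le_ecc {V : Type*} [Fintype V] (G : SimpleGraph V) (a b : V) :
    G.dist a b ≤ ecc G a :=
  Finset.le_sup (f := fun v => G.dist a v) (Finset.mem_univ b)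

/-- In a connected AT-free graph with no universal vertex and a numbering `σ`
satisfying the LexBFS properties (P1), (P2), (P3) with respect to `u`:
for nonadjacent `x, y` in the last distance layer from `u` with `σ⁻¹(x) < σ⁻¹(y)`,
one has `e(x) ≥ e(y)`. -/
theorem lexbfs_ecc_mono {V : Type*} [Fintype V] (G : SimpleGraph V)
    (hconn : G.Connected) (hAT : ATFree G)
    (n : ℕ) (hn : n = Fintype.card V) (σ : Fin n ≃ V) (u : V)
    -- (P1): vertices farther from `u` get smaller numbers
    (hP1 : ∀ y z : V, G.dist u z < G.dist u y → σ.symm y < σ.symm z)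
    -- (P2): for every `y`, the pair `(u,y)` is dominating in the subgraph induced by
    -- the vertices numbered at least `σ⁻¹(y)`
    (hP2 : ∀ y x : V, σ.symm y ≤ σ.symm x →
      ∀ p : G.Walk u y, p.IsPath → (∀ w ∈ p.support, σ.symm y ≤ σ.symm w) →
      ∃ z ∈ p.support, z ∈ closedNbhd G x)
    -- (P3): neighbourhoods towards `u` are nested along the numbering within a layer
    (hP3 : ∀ (x y : V) (i : ℕ), ¬ G.Adj x y → G.dist u x = i → G.dist u y = i →
      σ.symm x < σ.symm y →
      (∀ z : V, G.Adj x z → G.dist u z = i - 1 → G.Adj y z) ∧ G.dist x y ≤ 2)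
    -- `G` has no universal vertex
    (huniv : ∀ w : V, ∃ z : V, z ≠ w ∧ ¬ G.Adj w z)
    (x y : V) (hadj : ¬ G.Adj x y)
    (hx : G.dist u x = ecc G u) (hy : G.dist u y = ecc G u)
    (hσ : σ.symm x < σ.symm y) :
    ecc G y ≤ ecc G x := by
  classical
  by_contra hlt
  push Not at hlt
  have tri : ∀ a b c : V, G.dist a c ≤ G.dist a b + G.dist b c :=
    fun a b c => hconn.dist_triangle
  have cm : ∀ a b : V, G.dist a b = G.dist b a := fun a b => SimpleGraph.dist_comm
  have adj1 : ∀ a b : V, G.Adj a b → G.dist a b = 1 :=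
    fun a b h => SimpleGraph.dist_eq_one_iff_adj.mpr h
  have z0 : ∀ a b : V, G.dist a b = 0 → a = b := fun a b h => hconn.dist_eq_zero_iff.mp h
  have hP2' : ∀ y x : V, σ.symm y ≤ σ.symm x →
      ∀ p : G.Walk u y, (∀ w ∈ p.support, σ.symm y ≤ σ.symm w) →
      ∃ z ∈ p.support, z ∈ closedNbhd G x := by
    intro y x h p hp
    obtain ⟨z, hz, hz'⟩ := hP2 y x h p.bypass p.bypass_isPath
      (fun w hw => hp w (p.support_bypass_subset hw))
    exact ⟨z, p.support_bypass_subset hz, hz'⟩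
  obtain ⟨k, hk⟩ : ∃ k, ecc G u = k := ⟨_, rfl⟩
  rw [hk] at hx hy
  have hle : ∀ v, G.dist u v ≤ k := fun v => hk ▸ dist_le_ecc G u v
  have hk2 : 2 ≤ k := by
    obtain ⟨z, hz, hz'⟩ := huniv u
    have h1 : G.dist u z ≠ 0 := fun h => hz (z0 _ _ h).symm
    have h2 : G.dist u z ≠ 1 := fun h => hz' (SimpleGraph.dist_eq_one_iff_adj.mp h)
    have := hle z
    omega
  obtain ⟨t, -, ht⟩ := Finset.exists_mem_eq_sup (Finset.univ : Finset V) ⟨u, Finset.mem_univ u⟩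
    (fun v => G.dist y v)
  change ecc G y = G.dist y t at ht
  have hxu : k ≤ ecc G x := by
    have := dist_le_ecc G x u
    rw [cm x u, hx] at this
    exact this
  have hxt := dist_le_ecc G x t
  have hyt : k + 1 ≤ G.dist y t := by omega
  have hge : σ.symm y ≤ σ.symm t := by
    by_contra hcon
    push Not at hcon
    have htk : G.dist u t = k := by
      by_contra hne
      have := hP1 y t (by have := hle t; omega)
      exact absurd this (not_lt.mpr hcon.le)
    have hnadj : ¬ G.Adj t y := fun h => by
      have := adj1 _ _ h
      have := cm t y
      omega
    have := (hP3 t y k hnadj htk hy hcon).2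
    have := cm t y
    omega
  -- t is adjacent to u
  have hut : G.Adj u t := by
    obtain ⟨p, hp⟩ := hconn.exists_walk_length_eq_dist u y
    obtain ⟨v, hv, hv'⟩ := hP2' y t hge p (by
      intro w hw
      have h1 := walk_dist_sum G p hw
      by_cases hwk : G.dist u w = k
      · have : w = y := z0 _ _ (by omega)
        rw [this]
      · exact (hP1 y w (by have := hle w; omega)).le)
    have h1 := walk_dist_sum G p hv
    have h2 := tri y v t
    have h3 := cm v y
    rcases hv' with h | h
    · subst h
      omega
    · have h4 := adj1 _ _ h
      have h5 := cm t v
      have : u = v := z0 _ _ (by omega)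
      subst this
      exact h.symm
  have hut1 := adj1 _ _ hut
  have hyt2 : G.dist y t ≤ k + 1 := by
    have := tri y u t
    have := cm y u
    omega
  obtain ⟨p, hp⟩ := hconn.exists_walk_length_eq_dist x t
  have hpl : p.length ≤ k := by omega
  clear hp
  cases p with
  | nil =>
    have := tri y u x
    have := (hP3 x y k hadj hx hy hσ).2
    have := cm x y
    omega
  | @cons _ z _ hxz q =>
    rw [Walk.length_cons] at hpl
    have hzt := SimpleGraph.dist_le q
    have hyz : ¬ G.Adj y z := fun h => by
      have := adj1 _ _ h
      have := tri y z t
      omega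
    have hzk : G.dist u z = k := by
      by_contra hne
      have h1 := adj1 _ _ hxz
      have h2 := tri u z x
      have h3 := cm z x
      have h4 := hle z
      exact hyz ((hP3 x y k hadj hx hy hσ).1 z hxz (by omega))
    have hzy : z ≠ y := fun h => hadj (h ▸ hxz)
    have hσz : σ.symm y ≤ σ.symm z := by
      by_contra hcon
      push Not at hcon
      cases q with
      | nil => omega
      | @cons _ w _ hzw q' =>
        rw [Walk.length_cons] at hpl
        have h1 := SimpleGraph.dist_le q'
        have h2 := tri u t w
        have h3 := cm t w
        have h4 := tri u w z
        have h5 := cm w z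
        have h6 := adj1 _ _ hzw
        have h7 := (hP3 z y k (fun h => hyz h.symm) hzk hy hcon).1 w hzw (by omega)
        have h8 := adj1 _ _ h7
        have h9 := tri y w t
        omega
    obtain ⟨v, hv, hv'⟩ := hP2' x y hσ.le (Walk.cons hut (Walk.cons hxz q).reverse) (by
      intro w hw
      simp only [Walk.support_cons, List.mem_cons, Walk.support_reverse, List.mem_reverse] at hw
      rcases hw with rfl | rfl | hw
      · exact (hP1 x w (by rw [SimpleGraph.dist_self]; omega)).le
      · exact le_rfl
      · have h1 := walk_dist_sum G q hw
        by_cases hwk : G.dist u w = k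
        · have h2 := tri u t w
          have h3 := cm t w
          have : z = w := z0 _ _ (by omega)
          rw [← this]
          exact hσ.le.trans hσz
        · exact (hP1 x w (by have := hle w; omega)).le)
    simp only [Walk.support_cons, List.mem_cons, Walk.support_reverse, List.mem_reverse] at hv
    have h0 : G.dist y v ≤ 1 := by
      rcases hv' with h | h
      · rw [h, SimpleGraph.dist_self]; omega
      · rw [adj1 _ _ h]
    rcases hv with rfl | rfl | hv
    · have := cm y v
      omega
    · rcases hv' with h | h
      · rw [h] at hσ
        exact lt_irrefl _ hσ
      · exact hadj h.symm
    · have h1 := walk_dist_sum G q hv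
      have h2 := tri y v t
      omega
end

section
/- Let G be a connected AT-free graph on n vertices, let u be a vertex of G, and let σ : {1,…,n} → V be a bijective numbering of the vertices satisfying: (P1) for all vertices y,z, if dist(u,z) < dist(u,y) then σ⁻¹(z) > σ⁻¹(y); (P2) for every vertex y, the pair (u,y) is a dominating pair of the subgraph of G induced by { z : σ⁻¹(z) ≥ σ⁻¹(y) }; and (P3) for all nonadjacent vertices x,y with dist(u,x) = dist(u,y) = i and σ⁻¹(x) < σ⁻¹(y), one has N(x) ∩ { z : dist(u,z) = i−1 } ⊆ N(y) ∩ { z : dist(u,z) = i−1 }, and in particular dist(x,y) ≤ 2. Let v = σ(1), and let x,y be nonadjacent vertices with dist(v,x) = dist(v,y) = i and σ⁻¹(x) < σ⁻¹(y). Then for every vertex z with dist(v,z) > i, one has dist(y,z) ≤ max{ dist(x,z), 2 }. -/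
open SimpleGraph

theorem dist_add_of_mem_geod {V : Type*} (G : SimpleGraph V) (hconn : G.Connected) {a b w : V}
    (p : G.Walk a b) (hp : p.length = G.dist a b) (hw : w ∈ p.support) :
    G.dist a w + G.dist w b = G.dist a b := by
  classical
  have h1 := SimpleGraph.dist_le (p.takeUntil w hw)
  have h2 := SimpleGraph.dist_le (p.dropUntil w hw)
  have h3 : (p.takeUntil w hw).length + (p.dropUntil w hw).length = p.length := by
    rw [← SimpleGraph.Walk.length_append, SimpleGraph.Walk.take_spec]
  have h4 := hconn.dist_triangle (u := a) (v := w) (w := b)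
  omega

theorem dist_le_one_of_mem_closedNbhd {V : Type*} (G : SimpleGraph V) {x z : V}
    (h : z ∈ closedNbhd G x) : G.dist x z ≤ 1 := by
  rcases h with rfl | h
  · simp
  · exact le_of_eq (SimpleGraph.dist_eq_one_iff_adj.2 h)

/-- In a connected AT-free graph with a numbering `σ` satisfying the LexBFS
properties (P1), (P2), (P3) with respect to `u`, let `v = σ(1)` be the vertex with
the smallest number. Then for nonadjacent `x, y` in the same distance layer `i`
from `v` with `σ⁻¹(x) < σ⁻¹(y)`, every vertex `z` with `dist(v,z) > i` satisfies
`dist(y,z) ≤ max { dist(x,z), 2 }`. -/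
theorem lexbfs_dom_ecc_rev {V : Type*} [Fintype V] (G : SimpleGraph V)
    (hconn : G.Connected) (hAT : ATFree G)
    (n : ℕ) (hn : n = Fintype.card V) (σ : Fin n ≃ V) (u : V)
    -- (P1): vertices farther from `u` get smaller numbers
    (hP1 : ∀ y z : V, G.dist u z < G.dist u y → σ.symm y < σ.symm z)
    -- (P2): for every `y`, the pair `(u,y)` is dominating in the subgraph induced by
    -- the vertices numbered at least `σ⁻¹(y)`
    (hP2 : ∀ y x : V, σ.symm y ≤ σ.symm x →
      ∀ p : G.Walk u y, p.IsPath → (∀ w ∈ p.support, σ.symm y ≤ σ.symm w) →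
      ∃ z ∈ p.support, z ∈ closedNbhd G x)
    -- (P3): neighbourhoods towards `u` are nested along the numbering within a layer
    (hP3 : ∀ (x y : V) (i : ℕ), ¬ G.Adj x y → G.dist u x = i → G.dist u y = i →
      σ.symm x < σ.symm y →
      (∀ z : V, G.Adj x z → G.dist u z = i - 1 → G.Adj y z) ∧ G.dist x y ≤ 2)
    -- `v = σ(1)` is the vertex with the smallest number
    (v : V) (hv : ∀ w : V, σ.symm v ≤ σ.symm w)
    (x y : V) (i : ℕ) (hadj : ¬ G.Adj x y)
    (hx : G.dist v x = i) (hy : G.dist v y = i) (hσ : σ.symm x < σ.symm y) :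
    ∀ z : V, i < G.dist v z → G.dist y z ≤ max (G.dist x z) 2 := by
  classical
  intro z hz
  by_contra hcon
  rw [not_le, max_lt_iff] at hcon
  obtain ⟨hD1, hD2⟩ := hcon
  have tri : ∀ a b c : V, G.dist a c ≤ G.dist a b + G.dist b c :=
    fun a b c => hconn.dist_triangle
  have cm : ∀ a b : V, G.dist a b = G.dist b a := fun a b => SimpleGraph.dist_comm
  -- first walk: from `u` via `z` to `x`
  obtain ⟨R, hR⟩ := hconn.exists_walk_length_eq_dist u z
  obtain ⟨Q, hQ⟩ := hconn.exists_walk_length_eq_dist z x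
  have key1 : G.dist u y + 1 ≤ G.dist u z := by
    obtain ⟨a, ha, hmin⟩ := (R.append Q).support.toFinset.exists_min_image
      (fun w => σ.symm w) ⟨x, by simp⟩
    rw [List.mem_toFinset] at ha
    have hax : σ.symm a ≤ σ.symm x := hmin x (by simp)
    obtain ⟨s, hs, hsy⟩ := hP2 a y (hax.trans hσ.le) ((R.append Q).takeUntil a ha).bypass
      (SimpleGraph.Walk.bypass_isPath _) (fun w hw => hmin w (List.mem_toFinset.2
        (SimpleGraph.Walk.support_takeUntil_subset _ ha
          (SimpleGraph.Walk.support_bypass_subset _ hw))))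
    have hs' := SimpleGraph.Walk.support_takeUntil_subset _ ha
          (SimpleGraph.Walk.support_bypass_subset _ hs)
    have hd := dist_le_one_of_mem_closedNbhd G hsy
    rw [SimpleGraph.Walk.mem_support_append_iff] at hs'
    rcases hs' with h | h
    · have e := dist_add_of_mem_geod G hconn R hR h
      have t1 := tri y s z
      have t2 := tri u s y
      have := cm s y
      omega
    · have e := dist_add_of_mem_geod G hconn Q hQ h
      have t1 := tri y s z
      have c1 := cm s z
      have c2 := cm x z
      have h0 : G.dist s x = 0 := by omega
      have hsx : s = x := hconn.dist_eq_zero_iff.1 h0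
      subst hsx
      rcases hsy with h | h
      · subst h; exact absurd hσ (lt_irrefl _)
      · exact absurd h.symm hadj
  -- second walk: from `u` via `y` to `v`
  obtain ⟨A, hA⟩ := hconn.exists_walk_length_eq_dist u y
  obtain ⟨B, hB⟩ := hconn.exists_walk_length_eq_dist y v
  obtain ⟨s, hs, hsz⟩ := hP2 v z (hv z) (A.append B).bypass
    (SimpleGraph.Walk.bypass_isPath _) (fun w _ => hv w)
  have hs' := SimpleGraph.Walk.support_bypass_subset _ hs
  have hd := dist_le_one_of_mem_closedNbhd G hsz
  have c0 := cm s z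
  have t1 := tri y s z
  rw [SimpleGraph.Walk.mem_support_append_iff] at hs'
  rcases hs' with h | h
  · have e := dist_add_of_mem_geod G hconn A hA h
    have t2 := tri u s z
    have := cm s y
    omega
  · have e := dist_add_of_mem_geod G hconn B hB h
    have t2 := tri v s z
    have := cm s v
    have := cm y v
    omega
end

section
/- For every integer d ≥ 1 there exists an AT-free graph G and a set X of d vertices of G that is shattered by the closed neighbourhoods of G. In particular, the VC-dimension of the neighbourhood hypergraph of AT-free graphs is unbounded. -/
open SimpleGraph

/-- Co-bipartite incidence graph: two cliques, joined by membership. -/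
def incGraph (d : ℕ) : SimpleGraph (Fin d ⊕ Finset (Fin d)) where
  Adj := fun a b => match a, b with
    | .inl i, .inl j => i ≠ j
    | .inr S, .inr T => S ≠ T
    | .inl i, .inr S => i ∈ S
    | .inr S, .inl i => i ∈ S
  symm := ⟨by
    rintro (a | a) (b | b) h
    · exact Ne.symm h
    · exact h
    · exact h
    · exact Ne.symm h⟩
  loopless := ⟨by
    rintro (a | a) h
    · exact h rfl
    · exact h rfl⟩

theorem incGraph_ll {d : ℕ} (i j : Fin d) :
    (Sum.inl i : Fin d ⊕ Finset (Fin d)) ∈ closedNbhd (incGraph d) (Sum.inl j) := by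
  by_cases h : i = j
  · exact Or.inl (by rw [h])
  · exact Or.inr (Ne.symm h)

theorem incGraph_rr {d : ℕ} (i j : Finset (Fin d)) :
    (Sum.inr i : Fin d ⊕ Finset (Fin d)) ∈ closedNbhd (incGraph d) (Sum.inr j) := by
  by_cases h : i = j
  · exact Or.inl (by rw [h])
  · exact Or.inr (Ne.symm h)

/-- For every `d ≥ 1` there is an AT-free graph `G` together with a set `X` of `d`
vertices shattered by the closed neighbourhoods of `G`. Hence the VC-dimension of the
neighbourhood hypergraph of AT-free graphs is unbounded. -/
theorem atfree_vc_unbounded :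
    ∀ d : ℕ, 1 ≤ d →
      ∃ (V : Type) (_ : Fintype V) (G : SimpleGraph V) (X : Finset V),
        ATFree G ∧ X.card = d ∧
        ∀ Y ⊆ X, ∃ v : V, closedNbhd G v ∩ ↑X = ↑Y := by
  classical
  intro d _
  refine ⟨Fin d ⊕ Finset (Fin d), inferInstance, incGraph d,
    Finset.univ.map Function.Embedding.inl, ?_, by simp, ?_⟩
  · rintro x y z ⟨⟨p, -, hp⟩, ⟨q, -, hq⟩, -⟩
    have h1 := hp x p.start_mem_support
    have h2 := hp y p.end_mem_support
    have h3 := hq y q.start_mem_support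
    rcases x with x | x <;> rcases y with y | y <;> rcases z with z | z <;>
      first
      | exact h1 (incGraph_ll _ _)
      | exact h1 (incGraph_rr _ _)
      | exact h2 (incGraph_ll _ _)
      | exact h2 (incGraph_rr _ _)
      | exact h3 (incGraph_ll _ _)
      | exact h3 (incGraph_rr _ _)
  · intro Y hY
    refine ⟨Sum.inr (Finset.univ.filter fun i => Sum.inl i ∈ Y), ?_⟩
    ext v
    rcases v with i | S
    · simp [closedNbhd, incGraph]
    · have : Sum.inr S ∉ Y := fun h => by simpa using hY h
      simp [this]
end

section
/- For every integer k ≥ 1 there exists an AT-free graph G and a nonempty set W of vertices of G such that any k of the closed neighbourhoods N[w], w ∈ W, have a common vertex, yet the intersection of all the closed neighbourhoods N[w], w ∈ W, is empty. In particular, the Helly number of the neighbourhood hypergraph of AT-free graphs is unbounded. -/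
open SimpleGraph

/-- For every `k ≥ 1` there is an AT-free graph `G` and a nonempty set `W` of its
vertices whose closed neighbourhoods are `k`-wise intersecting but have empty common
intersection. Hence the Helly number of the neighbourhood hypergraph of AT-free graphs
is unbounded. -/
theorem atfree_helly_unbounded :
    ∀ k : ℕ, 1 ≤ k →
      ∃ (V : Type) (_ : Fintype V) (G : SimpleGraph V) (W : Finset V),
        ATFree G ∧ W.Nonempty ∧
        (∀ T ⊆ W, T.card ≤ k → ∃ c : V, ∀ w ∈ T, c ∈ closedNbhd G w) ∧
        ¬ ∃ c : V, ∀ w ∈ W, c ∈ closedNbhd G w := by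
  intro k _
  let G : SimpleGraph (Fin (k+1) × Bool) :=
    { Adj := fun x y => x.1 ≠ y.1
      symm := ⟨fun _ _ h => Ne.symm h⟩
      loopless := ⟨fun _ h => h rfl⟩ }
  have key : ∀ x z, z ∉ closedNbhd G x → z.1 = x.1 ∧ z.2 ≠ x.2 := by
    intro x z h
    have h' : ¬ (z = x ∨ x.1 ≠ z.1) := h
    push Not at h'
    exact ⟨h'.2.symm, fun e => h'.1 (Prod.ext h'.2.symm e)⟩
  refine ⟨Fin (k+1) × Bool, inferInstance, G, Finset.univ, ?_, ⟨(0, true), Finset.mem_univ _⟩, ?_, ?_⟩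
  · rintro x y z ⟨⟨p, -, hp⟩, ⟨q, -, hq⟩, -⟩
    have h1 := (key z x (hp x p.start_mem_support)).2
    have h2 := (key z y (hp y p.end_mem_support)).2
    have h3 := (key x y (hq y q.start_mem_support)).2
    revert h1 h2 h3
    cases x.2 <;> cases y.2 <;> cases z.2 <;> simp
  · intro T _ hT
    have : ∃ i, i ∉ T.image Prod.fst := by
      by_contra! h
      have h1 : (T.image Prod.fst) = Finset.univ := Finset.eq_univ_iff_forall.2 h
      have h2 := Finset.card_image_le (s := T) (f := Prod.fst)
      rw [h1, Finset.card_univ, Fintype.card_fin] at h2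
      omega
    obtain ⟨i, hi⟩ := this
    refine ⟨(i, true), fun w hw => Or.inr ?_⟩
    intro e
    exact hi (Finset.mem_image.2 ⟨w, hw, e⟩)
  · rintro ⟨c, hc⟩
    rcases hc (c.1, !c.2) (Finset.mem_univ _) with h | h
    · have := congrArg Prod.snd h
      simp at this
    · exact h rfl
end

section
/- Let G be a split graph whose vertex set is partitioned into a clique K and an independent set S, and let A ⊆ S with |A| ≥ 3. Then A is an asteroidal set of G if and only if the open neighbourhoods N(a), a ∈ A, are pairwise incomparable with respect to inclusion (i.e., for all distinct a, a' ∈ A, neither N(a) ⊆ N(a') nor N(a') ⊆ N(a)). -/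
open SimpleGraph

/-- `(K, S)` is a split partition of `G`: `K` is a clique, `S` is an independent set,
and they partition the vertex set. -/
def IsSplitPartition {V : Type*} (G : SimpleGraph V) (K S : Set V) : Prop :=
  G.IsClique K ∧ (∀ a ∈ S, ∀ b ∈ S, a ≠ b → ¬ G.Adj a b) ∧
    K ∪ S = Set.univ ∧ Disjoint K S

/-- `A` is an asteroidal set of `G`: it is an independent set and, for every `v ∈ A`,
any two vertices of `A \ {v}` are joined by a walk avoiding `N[v]` (i.e. they lie in the
same connected component of `G` minus `N[v]`). -/
def IsAsteroidalSet {V : Type*} (G : SimpleGraph V) (A : Set V) : Prop :=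
  (∀ a ∈ A, ∀ b ∈ A, a ≠ b → ¬ G.Adj a b) ∧
  ∀ v ∈ A, ∀ a ∈ A, a ≠ v → ∀ b ∈ A, b ≠ v →
    ∃ p : G.Walk a b, ∀ w ∈ p.support, w ∉ closedNbhd G v

/-- In a split graph with clique `K` and stable set `S`, a set `A ⊆ S` with `|A| ≥ 3`
is an asteroidal set if and only if the open neighbourhoods of its members are pairwise
incomparable with respect to inclusion. -/
theorem split_asteroidal_iff_incomparable {V : Type*} [Fintype V] (G : SimpleGraph V)
    (K S : Set V) (hsplit : IsSplitPartition G K S)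
    (A : Finset V) (hAS : ↑A ⊆ S) (hcard : 3 ≤ A.card) :
    IsAsteroidalSet G ↑A ↔
      ∀ a ∈ A, ∀ a' ∈ A, a ≠ a' → ¬ (G.neighborSet a ⊆ G.neighborSet a') := by
  obtain ⟨hK, hS, hU, hD⟩ := hsplit
  constructor
  · rintro ⟨_, h⟩ a ha a' ha' hne hsub
    obtain ⟨b, hb, hba, hba'⟩ : ∃ b ∈ A, b ≠ a ∧ b ≠ a' := by
      classical
      by_contra hcon
      push Not at hcon
      have hsub2 : A ⊆ {a, a'} := by
        intro b hb
        by_cases hb1 : b = a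
        · simp [hb1]
        · simp [hcon b hb hb1]
      have h1 := Finset.card_le_card hsub2
      have h2 := Finset.card_le_two (a := a) (b := a')
      omega
    obtain ⟨p, hp⟩ := h a' ha' a ha hne b hb hba'
    cases p with
    | nil => exact hba rfl
    | @cons _ x _ hadj q =>
      exact hp x (by simp) (Or.inr (hsub hadj))
  · intro h
    have hind : ∀ a ∈ A, ∀ b ∈ A, ¬ G.Adj a b := by
      intro a ha b hb hab
      exact hS a (hAS ha) b (hAS hb) hab.ne hab
    refine ⟨fun a ha b hb _ => hind a ha b hb, ?_⟩
    intro v hv a ha hav b hb hbv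
    have key : ∀ c ∈ A, c ≠ v → ∃ x, G.Adj c x ∧ ¬ G.Adj v x ∧ x ∈ K ∧ x ≠ v := by
      intro c hc hcv
      obtain ⟨x, hx, hx'⟩ := Set.not_subset.1 (h c hc v hv hcv)
      refine ⟨x, hx, hx', ?_, ?_⟩
      · have hxu : x ∈ K ∪ S := by rw [hU]; trivial
        rcases hxu with hk | hs
        · exact hk
        · exact absurd hx (hS c (hAS hc) x hs (G.ne_of_adj hx))
      · rintro rfl
        exact hind c hc x hv hx
    obtain ⟨x, hax, hvx, hxK, hxv⟩ := key a ha hav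
    obtain ⟨y, hby, hvy, hyK, hyv⟩ := key b hb hbv
    have hva := hind v hv a ha
    have hvb := hind v hv b hb
    by_cases hxy : x = y
    · subst hxy
      refine ⟨.cons hax (.cons hby.symm .nil), ?_⟩
      intro w hw
      simp at hw
      rcases hw with rfl | rfl | rfl <;> simp [closedNbhd, *]
    · refine ⟨.cons hax (.cons (hK hxK hyK hxy) (.cons hby.symm .nil)), ?_⟩
      intro w hw
      simp at hw
      rcases hw with rfl | rfl | rfl | rfl <;> simp [closedNbhd, *]
end

section
/- Let k ≥ 2 and let G be a split graph, with stable set S, whose asteroidal number is at most k. Then every set A ⊆ S whose open neighbourhoods N(a), a ∈ A, are pairwise incomparable with respect to inclusion (in particular pairwise distinct) has cardinality at most k. -/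
open SimpleGraph

/-- In a split graph, with stable set `S`, whose asteroidal number is at most `k ≥ 2`,
every `A ⊆ S` whose open neighbourhoods are pairwise incomparable w.r.t. inclusion has
cardinality at most `k`. -/
theorem split_incomparable_card_le {V : Type*} [Fintype V] (G : SimpleGraph V)
    (K S : Set V) (hsplit : IsSplitPartition G K S)
    (k : ℕ) (hk : 2 ≤ k)
    (hastnum : ∀ B : Finset V, IsAsteroidalSet G ↑B → B.card ≤ k)
    (A : Finset V) (hAS : ↑A ⊆ S)
    (hinc : ∀ a ∈ A, ∀ a' ∈ A, a ≠ a' → ¬ (G.neighborSet a ⊆ G.neighborSet a')) :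
    A.card ≤ k := by
  obtain ⟨hK, hS, hU, -⟩ := hsplit
  apply hastnum
  refine ⟨fun a ha b hb h => hS a (hAS ha) b (hAS hb) h, ?_⟩
  intro v hv a ha hav b hb hbv
  have key : ∀ c ∈ A, c ≠ v → c ∉ closedNbhd G v ∧
      ∃ x, G.Adj c x ∧ x ∈ K ∧ x ∉ closedNbhd G v := by
    intro c hc hcv
    have hvc : ¬ G.Adj v c := hS v (hAS hv) c (hAS hc) (Ne.symm hcv)
    refine ⟨fun h => h.elim hcv hvc, ?_⟩
    obtain ⟨x, hx, hxv⟩ := Set.not_subset.mp (hinc c hc v hv hcv)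
    have hx' : G.Adj c x := hx
    refine ⟨x, hx', ?_, ?_⟩
    · have : x ∈ K ∪ S := hU ▸ Set.mem_univ x
      rcases this with h | h
      · exact h
      · exact absurd hx' (hS c (hAS hc) x h hx'.ne)
    · rintro (h | h)
      · subst h
        exact hvc hx'.symm
      · exact hxv h
  obtain ⟨ha1, x, hax, hxK, hx⟩ := key a ha hav
  obtain ⟨hb1, y, hby, hyK, hy⟩ := key b hb hbv
  by_cases hxy : x = y
  · subst hxy
    refine ⟨.cons hax (.cons hby.symm .nil), ?_⟩
    intro w hw
    simp at hw
    rcases hw with rfl | rfl | rfl <;> assumption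
  · refine ⟨.cons hax (.cons (hK hxK hyK hxy) (.cons hby.symm .nil)), ?_⟩
    intro w hw
    simp at hw
    rcases hw with rfl | rfl | rfl | rfl <;> assumption
end

section
/- Every connected split graph is k-AT-free for every integer k ≥ 2; that is, a connected split graph contains no triple of distinct vertices x, y, z such that between any two of them there exists a path containing no vertex of the ball of radius k around the third. -/
open SimpleGraph

/-- `x, y, z` form a `k`-AT: they are pairwise distinct and between any two of them
there is a path containing no vertex of the ball of radius `k` around the third. -/
def IsKAT {V : Type*} (G : SimpleGraph V) (k : ℕ) (x y z : V) : Prop :=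
  x ≠ y ∧ y ≠ z ∧ x ≠ z ∧
  (∃ p : G.Walk x y, p.IsPath ∧ ∀ w ∈ p.support, k < G.dist z w) ∧
  (∃ p : G.Walk y z, p.IsPath ∧ ∀ w ∈ p.support, k < G.dist x w) ∧
  (∃ p : G.Walk x z, p.IsPath ∧ ∀ w ∈ p.support, k < G.dist y w)

theorem split_near {V : Type*} (G : SimpleGraph V)
    (hconn : G.Connected) (K S : Set V) (hsplit : IsSplitPartition G K S)
    (z w : V) (hw : w ∈ K) : G.dist z w ≤ 2 := by
  obtain ⟨hK, hS, hU, -⟩ := hsplit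
  have hor : ∀ a, a ∈ K ∨ a ∈ S := fun a => by
    have : a ∈ K ∪ S := hU ▸ Set.mem_univ a
    exact this
  have h1 : ∀ a ∈ K, G.dist a w ≤ 1 := by
    intro a ha
    by_cases h : a = w
    · subst h; simp
    · exact (SimpleGraph.dist_eq_one_iff_adj.2 (hK ha hw h)).le
  rcases hor z with hz | hz
  · exact (h1 z hz).trans (by norm_num)
  · obtain ⟨p⟩ := hconn.preconnected z w
    cases p with
    | nil => simp
    | @cons _ c _ h q =>
      have hc : c ∈ K := (hor c).resolve_right fun hc => hS z hz c hc h.ne h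
      have := hconn.dist_triangle (u := z) (v := c) (w := w)
      have := h1 c hc
      have := SimpleGraph.dist_eq_one_iff_adj.2 h
      omega

/-- Every connected split graph is `k`-AT-free for every `k ≥ 2`. -/
theorem split_kAT_free {V : Type*} [Fintype V] (G : SimpleGraph V)
    (hconn : G.Connected) (K S : Set V) (hsplit : IsSplitPartition G K S)
    (k : ℕ) (hk : 2 ≤ k) :
    ∀ x y z : V, ¬ IsKAT G k x y z := by
  rintro x y z ⟨hxy, -, -, ⟨p, -, hp⟩, -, -⟩
  obtain ⟨w, hw, hwK⟩ : ∃ w ∈ p.support, w ∈ K := by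
    obtain ⟨hK, hS, hU, -⟩ := hsplit
    have hor : ∀ a, a ∈ K ∨ a ∈ S := fun a => by
      have : a ∈ K ∪ S := hU ▸ Set.mem_univ a
      exact this
    cases p with
    | nil => exact absurd rfl hxy
    | @cons _ c _ h q =>
      rcases hor x with hx | hx
      · exact ⟨x, by simp, hx⟩
      · exact ⟨c, by simp, (hor c).resolve_right fun hc => hS x hx c hc h.ne h⟩
  have h1 := hp w hw
  have h2 := split_near G hconn K S hsplit z w hwK
  omega
end

section
/- Let G be a connected graph with diameter D, and suppose G contains a shortest path P between vertices x and y with dist(x,y) = D whose vertex set is a dominating set of G. If u and v are vertices of G with dist(u,x) = dist(u,y) = dist(v,x) = dist(v,y) = dist(u,v) = D − 1, then D ≤ 3. -/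
open SimpleGraph

/-- Let `G` be a connected graph of diameter `D` containing a dominating shortest path
`p` between two vertices `x, y` at distance `D`. If `u, v` are vertices with
`dist(u,x) = dist(u,y) = dist(v,x) = dist(v,y) = dist(u,v) = D - 1`, then `D ≤ 3`. -/
theorem dominating_diametral_path_diam_le_three {V : Type*} [Fintype V]
    (G : SimpleGraph V) (hconn : G.Connected) (D : ℕ)
    (hdiam : ∀ a b : V, G.dist a b ≤ D)
    (x y : V) (hxy : G.dist x y = D)
    (p : G.Walk x y) (hpath : p.IsPath) (hshort : p.length = G.dist x y)
    (hdom : ∀ w : V, ∃ z ∈ p.support, z ∈ closedNbhd G w)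
    (u v : V)
    (hux : G.dist u x = D - 1) (huy : G.dist u y = D - 1)
    (hvx : G.dist v x = D - 1) (hvy : G.dist v y = D - 1)
    (huv : G.dist u v = D - 1) :
    D ≤ 3 := by
  have key : ∀ w : V, G.dist w x = D - 1 → G.dist w y = D - 1 →
      ∃ i, D - 1 ≤ i + 1 ∧ D - 1 ≤ D - i + 1 ∧ i ≤ D ∧ G.dist w (p.getVert i) ≤ 1 := by
    intro w hwx hwy
    obtain ⟨z, hz, hzw⟩ := hdom w
    obtain ⟨i, rfl, hi⟩ := (SimpleGraph.Walk.mem_support_iff_exists_getVert).1 hz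
    have h1 : G.dist w (p.getVert i) ≤ 1 := by
      rcases hzw with h | h
      · rw [h]; simp
      · exact (SimpleGraph.dist_eq_one_iff_adj.2 h).le
    have h2 : G.dist x (p.getVert i) ≤ i :=
      (SimpleGraph.dist_le (p.take i)).trans (by simp [SimpleGraph.Walk.take_length])
    have h3 : G.dist (p.getVert i) y ≤ p.length - i :=
      (SimpleGraph.dist_le (p.drop i)).trans (by simp [SimpleGraph.Walk.drop_length])
    have h4 := hconn.dist_triangle (u := w) (v := p.getVert i) (w := x)
    have h5 := hconn.dist_triangle (u := w) (v := p.getVert i) (w := y)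
    rw [SimpleGraph.dist_comm] at h2
    exact ⟨i, by omega, by omega, by omega, h1⟩
  obtain ⟨i, a1, a2, a3, a4⟩ := key u hux huy
  obtain ⟨j, b1, b2, b3, b4⟩ := key v hvx hvy
  by_contra hD
  have hi : i = 2 := by omega
  have hj : j = 2 := by omega
  subst hi hj
  have h := hconn.dist_triangle (u := u) (v := p.getVert 2) (w := v)
  rw [SimpleGraph.dist_comm] at b4
  omega
end

section
/- In a connected chordal graph, every metric triangle x, y, z is equilateral of size at most two; that is, dist(x,y) = dist(y,z) = dist(z,x) ≤ 2. -/
open SimpleGraph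

/-- `G` is chordal: every cycle of length at least four has a chord, i.e. an edge of `G`
between two vertices of the cycle that is not an edge of the cycle. -/
def IsChordal {V : Type*} (G : SimpleGraph V) : Prop :=
  ∀ (v : V) (c : G.Walk v v), c.IsCycle → 4 ≤ c.length →
    ∃ a ∈ c.support, ∃ b ∈ c.support, G.Adj a b ∧ s(a, b) ∉ c.edges

/-- `x, y, z` form a metric triangle: any three shortest paths connecting them pairwise
intersect only in their common endpoints. -/
def IsMetricTriangle {V : Type*} (G : SimpleGraph V) (x y z : V) : Prop :=
  ∀ (p : G.Walk x y) (q : G.Walk y z) (r : G.Walk z x),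
    p.IsPath → p.length = G.dist x y →
    q.IsPath → q.length = G.dist y z →
    r.IsPath → r.length = G.dist z x →
    (∀ w, w ∈ p.support → w ∈ q.support → w = y) ∧
    (∀ w, w ∈ q.support → w ∈ r.support → w = z) ∧
    (∀ w, w ∈ r.support → w ∈ p.support → w = x)

theorem aux_chordless {V : Type*} (G : SimpleGraph V) (A : Set V) (u w : V)
    (p0 : G.Walk u w) (hp0 : ∀ v ∈ p0.support, v ∈ A) :
    ∃ p : G.Walk u w, p.IsPath ∧ (∀ v ∈ p.support, v ∈ A) ∧
      ∀ a ∈ p.support, ∀ b ∈ p.support, G.Adj a b → s(a, b) ∈ p.edges := by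
  classical
  have hex : ∃ n, ∃ p : G.Walk u w, p.length = n ∧ ∀ v ∈ p.support, v ∈ A :=
    ⟨_, p0, rfl, hp0⟩
  obtain ⟨p1, hl1, hA1⟩ := Nat.find_spec hex
  have hmin : ∀ q : G.Walk u w, (∀ v ∈ q.support, v ∈ A) → Nat.find hex ≤ q.length :=
    fun q hq => Nat.find_min' hex ⟨q, rfl, hq⟩
  have hsub : ∀ v ∈ p1.bypass.support, v ∈ A := fun v hv => hA1 v (p1.support_bypass_subset_support hv)
  have hlen : p1.bypass.length = Nat.find hex :=
    le_antisymm (hl1 ▸ p1.length_bypass_le_length) (hmin _ hsub)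
  generalize hp : p1.bypass = p at *
  have hpath : p.IsPath := hp ▸ p1.bypass_isPath
  refine ⟨p, hpath, hsub, ?_⟩
  have key : ∀ a b, ∀ (p1 : G.Walk u a) (p2 : G.Walk a b) (p3 : G.Walk b w),
      p1.append (p2.append p3) = p → G.Adj a b → s(a, b) ∈ p.edges := by
    intro a b p1 p2 p3 e hab
    subst e
    have h3 := hmin (p1.append (Walk.cons hab p3)) (by
      intro v hv
      apply hsub
      rw [Walk.mem_support_append_iff, Walk.support_cons, List.mem_cons] at hv
      rw [Walk.mem_support_append_iff, Walk.mem_support_append_iff]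
      rcases hv with hv | rfl | hv
      · exact .inl hv
      · exact .inl p1.end_mem_support
      · exact .inr (.inr hv))
    rw [← hlen, Walk.length_append, Walk.length_append, Walk.length_append, Walk.length_cons] at h3
    have h4 : p2.length ≤ 1 := by omega
    have h5 : s(a, b) ∈ p2.edges := by
      clear h3 hmin hlen hsub hpath hp
      match p2, h4 with
      | .nil, _ => exact absurd hab (G.irrefl)
      | .cons h .nil, _ => simp
      | .cons h (.cons h' r), h4 => simp at h4
    rw [Walk.edges_append, Walk.edges_append]
    simp [h5]
  intro a ha b hb hab
  have : b ∈ (p.takeUntil a ha).support ∨ b ∈ (p.dropUntil a ha).support := by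
    rw [← Walk.mem_support_append_iff, p.take_spec]; exact hb
  rcases this with h | h
  · rw [Sym2.eq_swap]
    refine key b a ((p.takeUntil a ha).takeUntil b h) ((p.takeUntil a ha).dropUntil b h)
      (p.dropUntil a ha) ?_ hab.symm
    rw [Walk.append_assoc, Walk.take_spec, Walk.take_spec]
  · refine key a b (p.takeUntil a ha) ((p.dropUntil a ha).takeUntil b h)
      ((p.dropUntil a ha).dropUntil b h) ?_ hab
    rw [Walk.take_spec, Walk.take_spec]

theorem aux_sep {V : Type*} (G : SimpleGraph V) (hch : IsChordal G) (S T : Set V) (u w : V)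
    (huw : u ≠ w) (hST : ∀ a ∈ S, ∀ b ∈ T, ¬ G.Adj a b) (hd : ∀ a ∈ S, a ∉ T)
    (p0 q0 : G.Walk u w) (hp0 : ∀ v ∈ p0.support, v = u ∨ v = w ∨ v ∈ S)
    (hq0 : ∀ v ∈ q0.support, v = u ∨ v = w ∨ v ∈ T) (huT : u ∉ T ∧ w ∉ T) 
    (huS : u ∉ S ∧ w ∉ S) : G.Adj u w := by
  by_contra hna
  obtain ⟨p, hp, hpS, hpc⟩ := aux_chordless G {v | v = u ∨ v = w ∨ v ∈ S} u w p0 hp0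
  obtain ⟨q, hq, hqT, hqc⟩ := aux_chordless G {v | v = u ∨ v = w ∨ v ∈ T} u w q0 hq0
  simp only [Set.mem_ofPred_eq] at hpS hqT
  have hlen : ∀ r : G.Walk u w, 2 ≤ r.length := by
    intro r
    match r with
    | .nil => exact absurd rfl huw
    | .cons h .nil => exact absurd h hna
    | .cons h (.cons h' r) => simp
  have hlp := hlen p
  have hlq := hlen q
  have hpq : ∀ v, v ∈ p.support → v ∈ q.support → v = u ∨ v = w := by
    intro v h1 h2
    have := hpS v h1; have := hqT v h2; have := hd v
    tauto
  have hcyc : (p.append q.reverse).IsCycle := by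
    match p, hp, hpq, hlp with
    | .cons (v := v) h p', hp, hpq, hlp =>
      rw [Walk.cons_append, Walk.cons_isCycle_iff]
      rw [Walk.cons_isPath_iff] at hp
      constructor
      · rw [Walk.isPath_def, Walk.support_append, List.nodup_append]
        refine ⟨hp.1.support_nodup, (hq.reverse).support_nodup.tail, ?_⟩
        intro a ha b hb hab
        subst hab
        have hb2 : a ∈ q.support := by
          have := List.mem_of_mem_tail hb
          simpa using this
        rcases hpq a (by simp [ha]) hb2 with rfl | rfl
        · exact hp.2 ha
        · have := hq.reverse.support_nodup
          rw [← Walk.cons_tail_support] at this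
          exact (List.nodup_cons.1 this).1 hb
      · rw [Walk.edges_append, List.mem_append, not_or]
        constructor
        · intro hh; exact hp.2 (p'.fst_mem_support_of_mem_edges hh)
        · intro hh
          have h2 := q.reverse.snd_mem_support_of_mem_edges hh
          rw [Walk.support_reverse, List.mem_reverse] at h2
          rcases hpq v (by simp) h2 with rfl | rfl
          · exact h.ne rfl
          · exact hna h
  obtain ⟨a, ha, b, hb, hab, hn⟩ := hch u _ hcyc (by
    rw [Walk.length_append, Walk.length_reverse]; omega)
  rw [Walk.mem_support_append_iff, Walk.support_reverse, List.mem_reverse] at ha hb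
  rw [Walk.edges_append, Walk.edges_reverse, List.mem_append, List.mem_reverse, not_or] at hn
  have hu := p.start_mem_support
  have hw := p.end_mem_support
  have hu' := q.start_mem_support
  have hw' := q.end_mem_support
  have hP : ¬ (a ∈ p.support ∧ b ∈ p.support) := fun h => hn.1 (hpc a h.1 b h.2 hab)
  have hQ : ¬ (a ∈ q.support ∧ b ∈ q.support) := fun h => hn.2 (hqc a h.1 b h.2 hab)
  have h1 := hpS a
  have h2 := hpS b
  have h3 := hqT a
  have h4 := hqT b
  have h5 := hST a
  have h6 := hST b
  rcases ha with ha | ha <;> rcases hb with hb | hb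
  · exact hP ⟨ha, hb⟩
  · rcases hpS a ha with rfl | rfl | h
    · exact hQ ⟨hu', hb⟩
    · exact hQ ⟨hw', hb⟩
    · rcases hqT b hb with rfl | rfl | h'
      · exact hP ⟨ha, hu⟩
      · exact hP ⟨ha, hw⟩
      · exact hST a h b h' hab
  · rcases hpS b hb with rfl | rfl | h
    · exact hQ ⟨ha, hu'⟩
    · exact hQ ⟨ha, hw'⟩
    · rcases hqT a ha with rfl | rfl | h'
      · exact hP ⟨hu, hb⟩
      · exact hP ⟨hw, hb⟩
      · exact hST b h a h' hab.symm
  · exact hQ ⟨ha, hb⟩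

theorem aux_geod {V : Type*} (G : SimpleGraph V) (hc : G.Connected) (x u : V) :
    ∃ p : G.Walk u x, ∀ v ∈ p.support, v = u ∨ G.dist x v < G.dist x u := by
  classical
  obtain ⟨p, hp⟩ := hc.exists_walk_length_eq_dist u x
  refine ⟨p, fun v hv => ?_⟩
  by_cases h : v = u
  · exact .inl h
  right
  have e := congrArg Walk.length (p.take_spec hv)
  rw [Walk.length_append] at e
  have h1 := G.dist_le (p.dropUntil v hv)
  have h2 := G.dist_le (p.takeUntil v hv)
  have h3 := hc.pos_dist_of_ne (Ne.symm h)
  rw [G.dist_comm (u := x) (v := v), G.dist_comm (u := x) (v := u)]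
  omega

theorem aux_layer {V : Type*} (G : SimpleGraph V) (hc : G.Connected) (hch : IsChordal G)
    (x u w : V) (c : ℕ) (hu : G.dist x u = c) (hw : G.dist x w = c)
    (p : G.Walk u w) (hp : ∀ v ∈ p.support, v = u ∨ v = w ∨ c < G.dist x v) :
    u = w ∨ G.Adj u w := by
  by_cases huw : u = w
  · exact .inl huw
  right
  obtain ⟨q1, h1⟩ := aux_geod G hc x u
  obtain ⟨q2, h2⟩ := aux_geod G hc x w
  refine aux_sep G hch {v | c < G.dist x v} {v | G.dist x v < c} u w huw ?_ ?_ p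
    (q1.append q2.reverse) hp ?_ ?_ ?_
  · intro a ha b hb hab
    have h3 := hc.dist_triangle (u := x) (v := b) (w := a)
    have h4 : G.dist b a = 1 := dist_eq_one_iff_adj.2 hab.symm
    simp only [Set.mem_ofPred_eq] at ha hb
    omega
  · intro a ha hb
    simp only [Set.mem_ofPred_eq] at ha hb
    omega
  · intro v hv
    rw [Walk.mem_support_append_iff, Walk.support_reverse, List.mem_reverse] at hv
    simp only [Set.mem_ofPred_eq]
    rcases hv with hv | hv
    · have := h1 v hv; rw [hu] at this; tauto
    · have := h2 v hv; rw [hw] at this; tauto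
  · simp [hu, hw]
  · simp [hu, hw]

theorem aux_walk {V : Type*} (G : SimpleGraph V) (f : ℕ → V) (a n : ℕ)
    (h : ∀ i, a ≤ i → i < a + n → G.Adj (f i) (f (i+1))) :
    ∃ p : G.Walk (f a) (f (a + n)), ∀ v ∈ p.support, ∃ i, a ≤ i ∧ i ≤ a + n ∧ v = f i := by
  induction n with
  | zero => exact ⟨.nil, by simp; exact ⟨a, le_rfl, le_rfl, rfl⟩⟩
  | succ n ih =>
    obtain ⟨p, hp⟩ := ih (fun i h1 h2 => h i h1 (by omega))
    refine ⟨p.concat (h (a+n) (by omega) (by omega)), fun v hv => ?_⟩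
    rw [Walk.support_concat, List.mem_append, List.mem_singleton] at hv
    rcases hv with hv | rfl
    · obtain ⟨i, h1, h2, h3⟩ := hp v hv
      exact ⟨i, h1, by omega, h3⟩
    · exact ⟨a + (n+1), by omega, le_rfl, rfl⟩

theorem aux_seq {V : Type*} (G : SimpleGraph V) (hc : G.Connected) (y z : V) :
    ∃ f : ℕ → V, f 0 = y ∧ f (G.dist y z) = z ∧
      (∀ i, i < G.dist y z → G.Adj (f i) (f (i+1))) ∧
      (∀ i j, i ≤ j → j ≤ G.dist y z → G.dist (f i) (f j) = j - i) := by
  obtain ⟨p, hp⟩ := hc.exists_walk_length_eq_dist y z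
  have hadj : ∀ i, i < G.dist y z → G.Adj (p.getVert i) (p.getVert (i+1)) :=
    fun i hi => p.adj_getVert_succ (hp ▸ hi)
  have hle : ∀ i n, i + n ≤ G.dist y z → G.dist (p.getVert i) (p.getVert (i+n)) ≤ n := by
    intro i n
    induction n with
    | zero => simp
    | succ n ih =>
      intro h
      have h1 := ih (by omega)
      have h2 := hc.dist_triangle (u := p.getVert i) (v := p.getVert (i+n)) (w := p.getVert (i+n+1))
      have h3 : G.dist (p.getVert (i+n)) (p.getVert (i+n+1)) = 1 :=
        dist_eq_one_iff_adj.2 (hadj _ (by omega))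
      rw [← add_assoc]
      omega
  have e0 : p.getVert 0 = y := p.getVert_zero
  have e1 : p.getVert (G.dist y z) = z := by rw [← hp]; exact p.getVert_length
  refine ⟨p.getVert, e0, e1, hadj, ?_⟩
  intro i j hij hj
  have h1 := hle 0 i (by omega)
  have h2 := hle i (j - i) (by omega)
  have h3 := hle j (G.dist y z - j) (by omega)
  rw [show i + (j - i) = j by omega] at h2
  rw [show j + (G.dist y z - j) = G.dist y z by omega, e1] at h3
  rw [zero_add, e0] at h1
  have h4 := hc.dist_triangle (u := y) (v := p.getVert i) (w := z)
  have h5 := hc.dist_triangle (u := p.getVert i) (v := p.getVert j) (w := z)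
  omega

theorem aux_down {V : Type*} (G : SimpleGraph V) (hc : G.Connected) (x y : V)
    (h : 0 < G.dist x y) : ∃ w, G.Adj y w ∧ G.dist x w + 1 = G.dist x y := by
  obtain ⟨f, h0, h1, h2, h3⟩ := aux_seq G hc y x
  rw [G.dist_comm] at h
  refine ⟨f 1, h0 ▸ h2 0 h, ?_⟩
  have := h3 1 (G.dist y x) h le_rfl
  rw [h1] at this
  rw [G.dist_comm (u := x), G.dist_comm (u := x), this]
  omega

theorem aux_main {V : Type*} (G : SimpleGraph V) (hc : G.Connected) (hch : IsChordal G)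
    (x y z : V) (hy : ∀ v, G.dist y v + G.dist v x = G.dist y x →
      G.dist y v + G.dist v z = G.dist y z → v = y) (hle : G.dist x z ≤ G.dist x y) :
    G.dist x y = G.dist x z ∧ G.dist y z ≤ 2 := by
  classical
  obtain ⟨f, f0, fm, fadj, fd⟩ := aux_seq G hc y z
  set m := G.dist y z with hm
  set k := G.dist x y with hk
  rcases Nat.eq_zero_or_pos k with hk0 | hkpos
  · have e1 : x = y := hc.dist_eq_zero_iff.1 hk0
    have e2 : x = z := hc.dist_eq_zero_iff.1 (by omega)
    subst e1 e2
    simp [hm, hk]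
  have step : ∀ i, i < m → G.dist x (f i) ≤ G.dist x (f (i+1)) + 1 ∧
      G.dist x (f (i+1)) ≤ G.dist x (f i) + 1 := by
    intro i hi
    have h1 : G.dist (f i) (f (i+1)) = 1 := dist_eq_one_iff_adj.2 (fadj i hi)
    have h2 := hc.dist_triangle (u := x) (v := f i) (w := f (i+1))
    have h3 := hc.dist_triangle (u := x) (v := f (i+1)) (w := f i)
    rw [G.dist_comm (u := f (i+1))] at h3
    omega
  have hfle : ∀ i, i ≤ m → G.dist x (f i) ≤ k := by
    by_contra! hcon
    obtain ⟨i, him, hi⟩ := hcon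
    -- last index before
    have ha := Nat.findGreatest_spec (P := fun a => G.dist x (f a) ≤ k) (n := i) (Nat.zero_le i)
      (by simp only [f0]; exact hk.ge)
    have ha2 : ∀ t, _ → t ≤ i → ¬ _ := fun t h1 h2 =>
      Nat.findGreatest_is_greatest (P := fun a => G.dist x (f a) ≤ k) (n := i) (k := t) h1 h2
    have ha1 := Nat.findGreatest_le (P := fun a => G.dist x (f a) ≤ k) i
    generalize Nat.findGreatest (fun a => G.dist x (f a) ≤ k) i = a at ha ha1 ha2
    have hex : ∃ b, i ≤ b ∧ G.dist x (f b) ≤ k := ⟨m, him, by rw [fm]; exact hle⟩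
    have hb := Nat.find_spec hex
    have hb1 : Nat.find hex ≤ m := Nat.find_min' hex ⟨him, by rw [fm]; exact hle⟩
    have hb2 : ∀ t, t < Nat.find hex → ¬ (i ≤ t ∧ G.dist x (f t) ≤ k) := fun t => Nat.find_min hex
    generalize Nat.find hex = b at hb hb1 hb2
    have hai : a < i := lt_of_le_of_ne ha1 (by rintro rfl; omega)
    have hib : i < b := lt_of_le_of_ne hb.1 (by rintro rfl; omega)
    have hmid : ∀ t, a < t → t < b → k < G.dist x (f t) := by
      intro t h1 h2
      by_cases h : t ≤ i
      · exact not_le.1 (ha2 t h1 h)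
      · have := hb2 t h2
        omega
    have hak : G.dist x (f a) = k := by
      have := step a (by omega)
      have := hmid (a+1) (by omega) (by omega)
      omega
    have hbk : G.dist x (f b) = k := by
      have h1 := step (b-1) (by omega)
      have h2 := hmid (b-1) (by omega) (by omega)
      rw [show b - 1 + 1 = b by omega] at h1
      omega
    obtain ⟨n, rfl⟩ : ∃ n, b = a + n := ⟨b - a, by omega⟩
    obtain ⟨p, hp⟩ := aux_walk G f a n (fun t h1 h2 => fadj t (by omega))
    have hd := fd a (a+n) (by omega) hb1
    rcases aux_layer G hc hch x _ _ k hak hbk p (by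
      intro v hv
      obtain ⟨t, h1, h2, rfl⟩ := hp v hv
      rcases eq_or_lt_of_le h1 with rfl | h1
      · exact .inl rfl
      rcases eq_or_lt_of_le h2 with rfl | h2
      · exact .inr (.inl rfl)
      exact .inr (.inr (hmid t h1 h2))) with h | h
    · rw [h, G.dist_self] at hd
      omega
    · rw [dist_eq_one_iff_adj.2 h] at hd
      omega
  obtain ⟨w, hyw, hxw⟩ := aux_down G hc x y hkpos
  have hyw1 : G.dist y w = 1 := dist_eq_one_iff_adj.2 hyw
  have hwne : w ≠ y := hyw.ne'
  have hwno : ∀ j, j ≤ m → 1 ≤ j → G.dist w (f j) ≤ j - 1 → False := by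
    intro j hj hj1 h
    apply hwne
    apply hy
    · rw [G.dist_comm (u := w), G.dist_comm (u := y) (v := x)]; omega
    · have h1 := hc.dist_triangle (u := w) (v := f j) (w := z)
      have h2 := fd j m hj le_rfl
      rw [fm] at h2
      have h3 := hc.dist_triangle (u := y) (v := w) (w := z)
      omega
  have hfge : ∀ i, i ≤ m → k ≤ G.dist x (f i) := by
    by_contra! hex
    have hj := Nat.find_spec hex
    have hj2 : ∀ t, t < Nat.find hex → ¬ (t ≤ m ∧ G.dist x (f t) < k) := fun t => Nat.find_min hex
    generalize Nat.find hex = j at hj hj2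
    obtain ⟨hjm, hjk⟩ := hj
    have hj0 : j ≠ 0 := by rintro rfl; rw [f0] at hjk; omega
    have hjk1 : G.dist x (f j) = G.dist x w := by
      have h1 := step (j-1) (by omega)
      have h2 := hj2 (j-1) (by omega)
      rw [show j - 1 + 1 = j by omega] at h1
      omega
    have hw := aux_walk G f 0 j (fun t h1 h2 => fadj t (by omega))
    rw [zero_add, f0] at hw
    obtain ⟨p, hp⟩ := hw
    have hd := fd 0 j (by omega) hjm
    rw [f0] at hd
    have ht := hc.dist_triangle (u := y) (v := w) (w := f j)
    rcases aux_layer G hc hch x w (f j) _ rfl hjk1 (Walk.cons hyw.symm p) (by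
      intro v hv
      rw [Walk.support_cons, List.mem_cons] at hv
      rcases hv with rfl | hv
      · exact .inl rfl
      obtain ⟨t, h1, h2, rfl⟩ := hp v hv
      rcases eq_or_lt_of_le h2 with rfl | h2
      · exact .inr (.inl rfl)
      have := hj2 t h2
      exact .inr (.inr (by omega))) with h | h
    · exact hwno j hjm (by omega) (by rw [← h, G.dist_self]; omega)
    · have h1 := dist_eq_one_iff_adj.2 h
      by_cases hj1 : j = 1
      · subst hj1
        have hne : f 1 ≠ y := by
          intro h; rw [h, G.dist_self] at hd; omega
        apply hne
        apply hy
        · rw [G.dist_comm (u := f 1), G.dist_comm (u := y) (v := x)]; omega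
        · have h2 := fd 1 m hjm le_rfl
          rw [fm] at h2
          omega
      · exact hwno j hjm (by omega) (by omega)
  have hfeq : ∀ i, i ≤ m → G.dist x (f i) = k := fun i hi => le_antisymm (hfle i hi) (hfge i hi)
  refine ⟨by rw [← fm]; exact (hfeq m le_rfl).symm, ?_⟩
  by_contra! hm3
  obtain ⟨w', hyw', hxw'⟩ := aux_down G hc x (f 3) (by rw [hfeq 3 hm3]; exact hkpos)
  rw [hfeq 3 hm3] at hxw'
  have hw := aux_walk G f 0 3 (fun t h1 h2 => fadj t (by omega))
  rw [zero_add, f0] at hw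
  obtain ⟨p, hp⟩ := hw
  have ht := hc.dist_triangle (u := w) (v := w') (w := f 3)
  have h1 : G.dist w' (f 3) = 1 := dist_eq_one_iff_adj.2 hyw'.symm
  refine hwno 3 hm3 (by omega) ?_
  rcases aux_layer G hc hch x w w' _ rfl (by omega) (Walk.cons hyw.symm (p.concat hyw')) (by
      intro v hv
      rw [Walk.support_cons, List.mem_cons, Walk.support_concat, 
        List.mem_append, List.mem_singleton] at hv
      rcases hv with rfl | hv | rfl
      · exact .inl rfl
      · obtain ⟨t, h1, h2, rfl⟩ := hp v hv
        have := hfeq t (by omega)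
        exact .inr (.inr (by omega))
      · exact .inr (.inl rfl)) with h | h
  · rw [h]; omega
  · have h2 := dist_eq_one_iff_adj.2 h
    omega

theorem aux_mt {V : Type*} (G : SimpleGraph V) (hc : G.Connected)
    (x y z v : V) (h1 : G.dist x v + G.dist v y = G.dist x y) 
    (h2 : G.dist z v + G.dist v y = G.dist z y) :
    ∃ (p : G.Walk x y) (q : G.Walk y z), p.IsPath ∧ p.length = G.dist x y ∧ q.IsPath ∧
      q.length = G.dist y z ∧ v ∈ p.support ∧ v ∈ q.support := by
  obtain ⟨p1, hp1⟩ := hc.exists_walk_length_eq_dist x v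
  obtain ⟨p2, hp2⟩ := hc.exists_walk_length_eq_dist v y
  obtain ⟨q1, hq1⟩ := hc.exists_walk_length_eq_dist y v
  obtain ⟨q2, hq2⟩ := hc.exists_walk_length_eq_dist v z
  have e1 : (p1.append p2).length = G.dist x y := by rw [Walk.length_append]; omega
  have e2 : (q1.append q2).length = G.dist y z := by
    rw [Walk.length_append, hq1, hq2, G.dist_comm (u := y), G.dist_comm (u := v) (v := z),
      G.dist_comm (u := y) (v := z)]; omega
  exact ⟨_, _, Walk.isPath_of_length_eq_dist _ e1, e1, Walk.isPath_of_length_eq_dist _ e2, e2,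
    by simp, by simp⟩

/-- In a connected chordal graph, every metric triangle is equilateral of size at most
two. -/
theorem chordal_metric_triangle_equilateral {V : Type*} [Fintype V]
    (G : SimpleGraph V) (hconn : G.Connected) (hchordal : IsChordal G)
    (x y z : V) (hmt : IsMetricTriangle G x y z) :
    G.dist x y = G.dist y z ∧ G.dist y z = G.dist z x ∧ G.dist z x ≤ 2 := by
  have geo : ∀ a b : V, ∃ p : G.Walk a b, p.IsPath ∧ p.length = G.dist a b := by
    intro a b
    obtain ⟨p, hp⟩ := hconn.exists_walk_length_eq_dist a b
    exact ⟨p, Walk.isPath_of_length_eq_dist _ hp, hp⟩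
  have c1 := G.dist_comm (u := x) (v := y)
  have c2 := G.dist_comm (u := y) (v := z)
  have c3 := G.dist_comm (u := z) (v := x)
  have hy : ∀ v, G.dist y v + G.dist v x = G.dist y x →
      G.dist y v + G.dist v z = G.dist y z → v = y := by
    intro v h1 h2
    rw [G.dist_comm (u := y) (v := v), G.dist_comm (u := v) (v := x)] at h1
    rw [G.dist_comm (u := y) (v := v), G.dist_comm (u := v) (v := z)] at h2
    obtain ⟨p, q, a, b, c, d, e, f⟩ := aux_mt G hconn x y z v (by omega) (by omega)
    obtain ⟨r, hr, hr'⟩ := geo z x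
    exact (hmt p q r a b c d hr hr').1 v e f
  have hz : ∀ v, G.dist z v + G.dist v x = G.dist z x →
      G.dist z v + G.dist v y = G.dist z y → v = z := by
    intro v h1 h2
    rw [G.dist_comm (u := z) (v := v), G.dist_comm (u := v) (v := x)] at h1
    rw [G.dist_comm (u := z) (v := v), G.dist_comm (u := v) (v := y)] at h2
    obtain ⟨p, q, a, b, c, d, e, f⟩ := aux_mt G hconn y z x v (by omega) (by omega)
    obtain ⟨r, hr, hr'⟩ := geo x y
    exact (hmt r p q hr hr' a b c d).2.1 v e f
  have hx : ∀ v, G.dist x v + G.dist v y = G.dist x y →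
      G.dist x v + G.dist v z = G.dist x z → v = x := by
    intro v h1 h2
    rw [G.dist_comm (u := x) (v := v), G.dist_comm (u := v) (v := y)] at h1
    rw [G.dist_comm (u := x) (v := v), G.dist_comm (u := v) (v := z)] at h2
    obtain ⟨p, q, a, b, c, d, e, f⟩ := aux_mt G hconn z x y v (by omega) (by omega)
    obtain ⟨r, hr, hr'⟩ := geo y z
    exact (hmt q r p c d hr hr' a b).2.2 v e f
  have A : G.dist x y = G.dist x z ∧ G.dist y z ≤ 2 := by
    rcases le_total (G.dist x z) (G.dist x y) with h | h
    · exact aux_main G hconn hchordal x y z hy h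
    · have := aux_main G hconn hchordal x z y hz h
      omega
  have B : G.dist y x = G.dist y z := by
    rcases le_total (G.dist y z) (G.dist y x) with h | h
    · exact (aux_main G hconn hchordal y x z hx h).1
    · exact (aux_main G hconn hchordal y z x (fun v a b => hz v b a) h).1.symm
  omega
end

section
/- Let G be a connected graph and let P be a shortest path between vertices u and v whose vertex set is a dominating set of G. Then every vertex w of G satisfies dist(u,w) + dist(w,v) ≤ dist(u,v) + 2. -/
open SimpleGraph

/-- If `p` is a dominating shortest path between `u` and `v` in a connected graph `G`,
then every vertex `w` satisfies `dist(u,w) + dist(w,v) ≤ dist(u,v) + 2`. -/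
theorem dominating_shortest_path_dist_sum {V : Type*} [Fintype V]
    (G : SimpleGraph V) (hconn : G.Connected) (u v : V)
    (p : G.Walk u v) (hpath : p.IsPath) (hshort : p.length = G.dist u v)
    (hdom : ∀ w : V, ∃ z ∈ p.support, z ∈ closedNbhd G w) :
    ∀ w : V, G.dist u w + G.dist w v ≤ G.dist u v + 2 := by
  intro w
  obtain ⟨z, hz, hzw⟩ := hdom w
  obtain ⟨q, r, hqr⟩ := SimpleGraph.Walk.mem_support_iff_exists_append.mp hz
  have hlen : p.length = q.length + r.length := by
    rw [hqr, SimpleGraph.Walk.length_append]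
  have h1 := SimpleGraph.dist_le q
  have h2 := SimpleGraph.dist_le r
  have h3 : G.dist w z ≤ 1 := by
    rcases hzw with h | h
    · subst h
      simp
    · exact (SimpleGraph.dist_eq_one_iff_adj.mpr h).le
  have h4 : G.dist u w ≤ G.dist u z + G.dist z w := hconn.dist_triangle
  have h5 : G.dist w v ≤ G.dist w z + G.dist z v := hconn.dist_triangle
  have h6 : G.dist z w = G.dist w z := SimpleGraph.dist_comm
  omega
end

section
/- Let G be a split graph whose vertex set is partitioned into a clique K and an independent set S. If X is a set of at least 3 vertices of G that is shattered by the closed neighbourhoods of G, then either X ⊆ K or X ⊆ S. -/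
open SimpleGraph

/-- In a split graph with clique `K` and stable set `S`, every set `X` of at least `3`
vertices shattered by the closed neighbourhoods satisfies `X ⊆ K` or `X ⊆ S`. -/
theorem split_shattered_subset {V : Type*} [Fintype V] (G : SimpleGraph V)
    (K S : Set V) (hsplit : IsSplitPartition G K S)
    (X : Finset V) (hcard : 3 ≤ X.card)
    (hshatter : ∀ Y ⊆ X, ∃ v : V, closedNbhd G v ∩ ↑X = ↑Y) :
    ↑X ⊆ K ∨ ↑X ⊆ S := by
  classical
  obtain ⟨hK, hS, hU, hD⟩ := hsplit
  have hcov : ∀ v, v ∈ K ∨ v ∈ S := fun v => by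
    have : v ∈ K ∪ S := by rw [hU]; trivial
    exact this
  by_contra hcon
  rw [not_or, Set.not_subset, Set.not_subset] at hcon
  obtain ⟨⟨s, hsX, hsK⟩, ⟨k, hkX, hkS⟩⟩ := hcon
  have hs : s ∈ S := (hcov s).resolve_left hsK
  have hk : k ∈ K := (hcov k).resolve_right hkS
  have hks : k ≠ s := fun h => hsK (h ▸ hk)
  have hsX' : s ∈ X := hsX
  have hkX' : k ∈ X := hkX
  have mem : ∀ Y ⊆ X, ∃ v : V, ∀ z ∈ X, (z = v ∨ G.Adj v z) ↔ z ∈ Y := by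
    intro Y hY
    obtain ⟨v, hv⟩ := hshatter Y hY
    refine ⟨v, fun z hz => ?_⟩
    have h := Set.ext_iff.1 hv z
    simpa [closedNbhd, hz] using h
  -- a vertex missing a clique vertex and meeting a stable vertex is that stable vertex
  have key : ∀ v a b, a ∈ K → b ∈ S → ¬ (a = v ∨ G.Adj v a) → (b = v ∨ G.Adj v b) →
      b = v := by
    intro v a b ha hb h1 h2
    rcases h2 with h2 | h2
    · exact h2
    · rcases hcov v with hv | hv
      · exact absurd (or_iff_not_imp_left.2 fun h => hK hv ha (Ne.symm h)) h1
      · exact absurd h2 (hS v hv b hb h2.ne)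
  obtain ⟨t, htX, ht⟩ : ∃ t ∈ X, t ∉ ({k, s} : Finset V) :=
    Finset.exists_mem_notMem_of_card_lt_card
      (lt_of_le_of_lt Finset.card_le_two (by omega))
  simp only [Finset.mem_insert, Finset.mem_singleton, not_or] at ht
  obtain ⟨htk, hts⟩ := ht
  rcases hcov t with htK | htS
  · obtain ⟨v, hv⟩ := mem {s} (by simpa using hsX')
    obtain ⟨w, hw⟩ := mem {s, k} (by simp [Finset.insert_subset_iff, hsX', hkX'])
    have e1 : s = v := key v t s htK hs (by rw [hv t htX]; simp [hts])
      (by rw [hv s hsX']; simp)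
    have e2 : s = w := key w t s htK hs (by rw [hw t htX]; simp [hts, htk])
      (by rw [hw s hsX']; simp)
    subst e1
    subst e2
    have h1 := (hw k hkX').2 (by simp)
    have h2 := (hv k hkX').1 h1
    exact hks (by simpa using h2)
  · obtain ⟨v, hv⟩ := mem {s, t} (by simp [Finset.insert_subset_iff, hsX', htX])
    have hn : ¬ (k = v ∨ G.Adj v k) := by
      rw [hv k hkX']; simp [hks, Ne.symm htk]
    have e1 : s = v := key v k s hk hs hn (by rw [hv s hsX']; simp)
    have e2 : t = v := key v k t hk htS hn (by rw [hv t htX]; simp)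
    exact hts (e2.trans e1.symm)
end

section
/- Every B1-free split graph has VC-dimension at most 3; that is, in a split graph with no induced subgraph isomorphic to B1, no set of 4 vertices is shattered by the closed neighbourhoods of the graph. -/
open SimpleGraph

/-- `G` contains an induced copy of `B₁`: a triangle `a₁ a₂ a₃` together with three
pendant vertices `b₁ b₂ b₃`, where `bᵢ` is adjacent only to `aᵢ`. -/
def HasInducedB1 {V : Type*} (G : SimpleGraph V) : Prop :=
  ∃ a₁ a₂ a₃ b₁ b₂ b₃ : V,
    [a₁, a₂, a₃, b₁, b₂, b₃].Pairwise (· ≠ ·) ∧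
    G.Adj a₁ a₂ ∧ G.Adj a₂ a₃ ∧ G.Adj a₁ a₃ ∧
    G.Adj a₁ b₁ ∧ G.Adj a₂ b₂ ∧ G.Adj a₃ b₃ ∧
    ¬ G.Adj a₁ b₂ ∧ ¬ G.Adj a₁ b₃ ∧ ¬ G.Adj a₂ b₁ ∧ ¬ G.Adj a₂ b₃ ∧
    ¬ G.Adj a₃ b₁ ∧ ¬ G.Adj a₃ b₂ ∧ ¬ G.Adj b₁ b₂ ∧ ¬ G.Adj b₁ b₃ ∧ ¬ G.Adj b₂ b₃

def Shat {V : Type*} (G : SimpleGraph V) (X : Finset V) : Prop :=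
  ∀ P : V → Prop, ∃ v, ∀ x ∈ X, ((x = v ∨ G.Adj v x) ↔ P x)

theorem shat_of {V : Type*} (G : SimpleGraph V) (X : Finset V)
    (h : ∀ Y ⊆ X, ∃ v : V, closedNbhd G v ∩ ↑X = ↑Y) : Shat G X := by
  classical
  intro P
  obtain ⟨v, hv⟩ := h (X.filter P) (Finset.filter_subset _ _)
  refine ⟨v, fun x hx => ?_⟩
  have := Set.ext_iff.1 hv x
  simpa [closedNbhd, hx] using this

theorem b1_of {V : Type*} (G : SimpleGraph V) (K S : Set V) (hs : IsSplitPartition G K S)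
    (a₁ a₂ a₃ b₁ b₂ b₃ : V) (ha₁ : a₁ ∈ K) (ha₂ : a₂ ∈ K) (ha₃ : a₃ ∈ K)
    (hb₁ : b₁ ∈ S) (hb₂ : b₂ ∈ S) (hb₃ : b₃ ∈ S)
    (h11 : G.Adj a₁ b₁) (h22 : G.Adj a₂ b₂) (h33 : G.Adj a₃ b₃)
    (h12 : ¬ G.Adj a₁ b₂) (h13 : ¬ G.Adj a₁ b₃) (h21 : ¬ G.Adj a₂ b₁)
    (h23 : ¬ G.Adj a₂ b₃) (h31 : ¬ G.Adj a₃ b₁) (h32 : ¬ G.Adj a₃ b₂) :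
    HasInducedB1 G := by
  obtain ⟨hK, hS, -, hd⟩ := hs
  have hne : ∀ a ∈ K, ∀ b ∈ S, a ≠ b := fun a ha b hb e =>
    Set.disjoint_left.1 hd ha (e ▸ hb)
  have e12 : a₁ ≠ a₂ := by rintro rfl; exact h12 h22
  have e13 : a₁ ≠ a₃ := by rintro rfl; exact h13 h33
  have e23 : a₂ ≠ a₃ := by rintro rfl; exact h23 h33
  have f12 : b₁ ≠ b₂ := by rintro rfl; exact h12 h11
  have f13 : b₁ ≠ b₃ := by rintro rfl; exact h13 h11
  have f23 : b₂ ≠ b₃ := by rintro rfl; exact h23 h22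
  refine ⟨a₁, a₂, a₃, b₁, b₂, b₃, ?_, hK ha₁ ha₂ e12, hK ha₂ ha₃ e23, hK ha₁ ha₃ e13,
    h11, h22, h33, h12, h13, h21, h23, h31, h32, hS _ hb₁ _ hb₂ f12, hS _ hb₁ _ hb₃ f13,
    hS _ hb₂ _ hb₃ f23⟩
  simp [*]

theorem caseK {V : Type*} (G : SimpleGraph V) (K S : Set V) (hs : IsSplitPartition G K S)
    (hB : ¬ HasInducedB1 G) (X : Finset V) (h : Shat G X) (x y z : V)
    (hx : x ∈ X) (hy : y ∈ X) (hz : z ∈ X) (hxy : x ≠ y) (hxz : x ≠ z) (hyz : y ≠ z)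
    (kx : x ∈ K) (ky : y ∈ K) (kz : z ∈ K) : False := by
  have hs' := hs
  obtain ⟨hK, hS, hu, hd⟩ := hs'
  have key : ∀ p q r : V, p ∈ X → q ∈ X → r ∈ X → p ∈ K → q ∈ K → r ∈ K → p ≠ q → p ≠ r →
      ∃ b ∈ S, G.Adj p b ∧ ¬ G.Adj q b ∧ ¬ G.Adj r b := by
    intro p q r hp hq hr kp kq kr hpq hpr
    obtain ⟨v, hv⟩ := h (fun t => t = p)
    have h1 := (hv p hp).2 rfl
    have h2 := fun e => hpq ((hv q hq).1 e).symm
    have h3 := fun e => hpr ((hv r hr).1 e).symm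
    have hvK : v ∉ K := fun hvK => h2 (by
      by_cases e : q = v
      · exact Or.inl e
      · exact Or.inr (hK hvK kq (Ne.symm e)))
    have hvS : v ∈ S := by
      have : v ∈ K ∪ S := hu ▸ Set.mem_univ v
      exact this.resolve_left hvK
    refine ⟨v, hvS, ?_, fun e => h2 (Or.inr e.symm), fun e => h3 (Or.inr e.symm)⟩
    rcases h1 with rfl | h1
    · exact absurd kp hvK
    · exact h1.symm
  obtain ⟨b₁, s1, p1, q1, r1⟩ := key x y z hx hy hz kx ky kz hxy hxz
  obtain ⟨b₂, s2, p2, q2, r2⟩ := key y x z hy hx hz ky kx kz hxy.symm hyz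
  obtain ⟨b₃, s3, p3, q3, r3⟩ := key z x y hz hx hy kz kx ky hxz.symm hyz.symm
  exact hB (b1_of G K S hs x y z b₁ b₂ b₃ kx ky kz s1 s2 s3 p1 p2 p3 q2 q3 q1 r3 r1 r2)

theorem caseS {V : Type*} (G : SimpleGraph V) (K S : Set V) (hs : IsSplitPartition G K S)
    (hB : ¬ HasInducedB1 G) (X : Finset V) (h : Shat G X) (w x y z : V) (hw : w ∈ X)
    (hx : x ∈ X) (hy : y ∈ X) (hz : z ∈ X) (hxy : x ≠ y) (hxz : x ≠ z) (hyz : y ≠ z)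
    (hwx : w ≠ x) (hwy : w ≠ y) (hwz : w ≠ z)
    (kx : x ∈ S) (ky : y ∈ S) (kz : z ∈ S) : False := by
  have hs' := hs
  obtain ⟨hK, hS, hu, hd⟩ := hs'
  have key : ∀ p q r : V, p ∈ X → q ∈ X → r ∈ X → p ∈ S → p ≠ q → p ≠ r →
      w ≠ p → w ≠ q → w ≠ r →
      ∃ a ∈ K, G.Adj a p ∧ ¬ G.Adj a q ∧ ¬ G.Adj a r := by
    intro p q r hp hq hr kp hpq hpr wp wq wr
    have main : ∃ v, v ≠ p ∧ (p = v ∨ G.Adj v p) ∧ ¬ G.Adj v q ∧ ¬ G.Adj v r := by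
      obtain ⟨v, hv⟩ := h (fun t => t = p)
      obtain ⟨v', hv'⟩ := h (fun t => t = p ∨ t = w)
      by_cases e : v = p
      · refine ⟨v', ?_, (hv' p hp).2 (Or.inl rfl), fun a => ?_, fun a => ?_⟩
        · intro e'
          have h1 := (hv' w hw).2 (Or.inr rfl)
          rw [e', ← e] at h1
          exact wp ((hv w hw).1 h1)
        · rcases (hv' q hq).1 (Or.inr a) with e | e
          · exact hpq e.symm
          · exact wq e.symm
        · rcases (hv' r hr).1 (Or.inr a) with e | e
          · exact hpr e.symm
          · exact wr e.symm
      · exact ⟨v, e, (hv p hp).2 rfl, fun a => hpq ((hv q hq).1 (Or.inr a)).symm,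
          fun a => hpr ((hv r hr).1 (Or.inr a)).symm⟩
    obtain ⟨v, hne, h1, h2, h3⟩ := main
    have h1 := h1.resolve_left (Ne.symm hne)
    have : v ∈ K ∪ S := hu ▸ Set.mem_univ v
    exact ⟨v, this.resolve_right (fun hv => hS v hv p kp hne h1), h1, h2, h3⟩
  obtain ⟨b₁, s1, p1, q1, r1⟩ := key x y z hx hy hz kx hxy hxz hwx hwy hwz
  obtain ⟨b₂, s2, p2, q2, r2⟩ := key y x z hy hx hz ky hxy.symm hyz hwy hwx hwz
  obtain ⟨b₃, s3, p3, q3, r3⟩ := key z x y hz hx hy kz hxz.symm hyz.symm hwz hwx hwy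
  exact hB (b1_of G K S hs b₁ b₂ b₃ x y z s1 s2 s3 kx ky kz p1 p2 p3 q1 r1 q2 r2 q3 r3)

theorem caseKS {V : Type*} (G : SimpleGraph V) (K S : Set V) (hs : IsSplitPartition G K S)
    (X : Finset V) (h : Shat G X) (x s t : V) (hx : x ∈ X) (hs' : s ∈ X) (ht : t ∈ X)
    (hst : s ≠ t) (kx : x ∈ K) (ks : s ∈ S) (kt : t ∈ S) : False := by
  obtain ⟨hK, hS, hu, hd⟩ := hs
  obtain ⟨v, hv⟩ := h (fun u => u = s ∨ u = t)
  have h1 := (hv s hs').2 (Or.inl rfl)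
  have h2 := (hv t ht).2 (Or.inr rfl)
  have hvS : v ∉ S := by
    intro hvS
    rcases h1 with rfl | h1
    · rcases h2 with rfl | h2
      · exact hst rfl
      · exact hS _ hvS _ kt hst h2
    · exact hS _ hvS _ ks h1.ne h1
  have : v ∈ K ∪ S := hu ▸ Set.mem_univ v
  have hvK := this.resolve_right hvS
  have h3 : x = v ∨ G.Adj v x := by
    by_cases e : x = v
    · exact Or.inl e
    · exact Or.inr (hK hvK kx (Ne.symm e))
  rcases (hv x hx).1 h3 with rfl | rfl
  · exact Set.disjoint_left.1 hd kx ks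
  · exact Set.disjoint_left.1 hd kx kt

/-- Every `B₁`-free split graph has VC-dimension at most `3`: no set of `4` vertices is
shattered by the closed neighbourhoods. -/
theorem b1_free_split_vc_le_three {V : Type*} [Fintype V] (G : SimpleGraph V)
    (K S : Set V) (hsplit : IsSplitPartition G K S)
    (hB1 : ¬ HasInducedB1 G) (X : Finset V) (hcard : X.card = 4) :
    ¬ ∀ Y ⊆ X, ∃ v : V, closedNbhd G v ∩ ↑X = ↑Y := by
  classical
  intro h0
  have h := shat_of G X h0
  obtain ⟨a, b, c, d, hab, hac, had, hbc, hbd, hcd, hX⟩ := Finset.card_eq_four.1 hcard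
  have ha : a ∈ X := by simp [hX]
  have hb : b ∈ X := by simp [hX]
  have hc : c ∈ X := by simp [hX]
  have hd : d ∈ X := by simp [hX]
  have T := caseKS G K S hsplit X h
  have A := caseK G K S hsplit hB1 X h
  have B := caseS G K S hsplit hB1 X h
  have hu : ∀ v, v ∈ K ∨ v ∈ S := fun v => by
    have : v ∈ K ∪ S := hsplit.2.2.1 ▸ Set.mem_univ v
    exact this
  rcases hu a with ka | ka <;> rcases hu b with kb | kb <;> rcases hu c with kc | kc <;>
    rcases hu d with kd | kd <;>
  first
  | exact A a b c ha hb hc hab hac hbc ka kb kc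
  | exact A a b d ha hb hd hab had hbd ka kb kd
  | exact A a c d ha hc hd hac had hcd ka kc kd
  | exact A b c d hb hc hd hbc hbd hcd kb kc kd
  | exact B d a b c hd ha hb hc hab hac hbc had.symm hbd.symm hcd.symm ka kb kc
  | exact B c a b d hc ha hb hd hab had hbd hac.symm hbc.symm hcd ka kb kd
  | exact B b a c d hb ha hc hd hac had hcd hab.symm hbc hbd ka kc kd
  | exact B a b c d ha hb hc hd hbc hbd hcd hab hac had kb kc kd
  | exact T a b c ha hb hc hbc ka kb kc
  | exact T a b d ha hb hd hbd ka kb kd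
  | exact T a c d ha hc hd hcd ka kc kd
  | exact T b a c hb ha hc hac kb ka kc
  | exact T b a d hb ha hd had kb ka kd
  | exact T c a b hc ha hb hab kc ka kb
end

section
/- Let G be a connected graph with diameter D, let P be a shortest path in G (between its two endpoints), and let u, v, w be three vertices that are pairwise at distance D − 1 from each other. If dist(u, V(P)) ≤ 2, dist(v, V(P)) ≤ 2, dist(w, V(P)) ≤ 2 and dist(u, V(P)) + dist(v, V(P)) ≤ 3, then D ≤ 9. -/
open SimpleGraph

/-- The distance from a vertex `x` to a set `s` of vertices:
`dist(x, s) = min { dist(x, z) : z ∈ s }`. -/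
noncomputable def distToSet {V : Type*} (G : SimpleGraph V) (x : V) (s : Set V) : ℕ :=
  sInf {d : ℕ | ∃ z ∈ s, G.dist x z = d}

theorem distToSet_aux {V : Type*} (G : SimpleGraph V) {a b : V} (p : G.Walk a b) (x : V) :
    ∃ i ≤ p.length, G.dist x (p.getVert i) = distToSet G x {z | z ∈ p.support} := by
  have hne : {d : ℕ | ∃ z ∈ {z | z ∈ p.support}, G.dist x z = d}.Nonempty :=
    ⟨_, a, p.start_mem_support, rfl⟩
  obtain ⟨z, hz, hd⟩ := Nat.sInf_mem hne
  obtain ⟨i, hi, hl⟩ := (SimpleGraph.Walk.mem_support_iff_exists_getVert).1 hz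
  exact ⟨i, hl, by rw [hi]; exact hd⟩

theorem dist_getVert_aux {V : Type*} (G : SimpleGraph V) (hconn : G.Connected) {a b : V}
    (p : G.Walk a b) (i n : ℕ) (h : i + n ≤ p.length) :
    G.dist (p.getVert i) (p.getVert (i + n)) ≤ n := by
  induction n with
  | zero => simp
  | succ n ih =>
    have h1 := ih (by omega)
    have h2 := p.adj_getVert_succ (i := i + n) (by omega)
    have h3 := SimpleGraph.dist_eq_one_iff_adj.2 h2
    have h4 := hconn.dist_triangle (u := p.getVert i) (v := p.getVert (i + n))
      (w := p.getVert (i + n + 1))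
    rw [← add_assoc]
    omega

theorem dist_pair_aux {V : Type*} (G : SimpleGraph V) (hconn : G.Connected) {a b : V}
    (p : G.Walk a b) (x y : V) (i j : ℕ) (hi : i ≤ p.length) (hj : j ≤ p.length) :
    G.dist x y ≤ G.dist x (p.getVert i) + G.dist y (p.getVert j) + ((i - j) + (j - i)) := by
  have h1 := hconn.dist_triangle (u := x) (v := p.getVert i) (w := y)
  have h2 := hconn.dist_triangle (u := p.getVert i) (v := p.getVert j) (w := y)
  have h3 : G.dist (p.getVert j) y = G.dist y (p.getVert j) := SimpleGraph.dist_comm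
  have h4 : G.dist (p.getVert i) (p.getVert j) ≤ (i - j) + (j - i) := by
    rcases le_total i j with h | h
    · obtain ⟨n, rfl⟩ := Nat.exists_eq_add_of_le h
      have := dist_getVert_aux G hconn p i n hj
      omega
    · obtain ⟨n, rfl⟩ := Nat.exists_eq_add_of_le h
      have := dist_getVert_aux G hconn p j n hi
      rw [SimpleGraph.dist_comm]
      omega
  omega

/-- Let `G` be a connected graph of diameter `D`, let `p` be a shortest path in `G`, and
let `u, v, w` be pairwise at distance `D - 1` from each other. If each of `u, v, w` is at
distance at most `2` from `V(p)` and `dist(u, V(p)) + dist(v, V(p)) ≤ 3`, then `D ≤ 9`. -/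
theorem three_far_vertices_near_shortest_path_diam_le_nine {V : Type*} [Fintype V]
    (G : SimpleGraph V) (hconn : G.Connected) (D : ℕ)
    (hdiam : ∀ a b : V, G.dist a b ≤ D) (hex : ∃ a b : V, G.dist a b = D)
    (a b : V) (p : G.Walk a b) (hpath : p.IsPath) (hshort : p.length = G.dist a b)
    (u v w : V)
    (huv : G.dist u v = D - 1) (huw : G.dist u w = D - 1) (hvw : G.dist v w = D - 1)
    (hu : distToSet G u {z | z ∈ p.support} ≤ 2)
    (hv : distToSet G v {z | z ∈ p.support} ≤ 2)
    (hw : distToSet G w {z | z ∈ p.support} ≤ 2)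
    (hsum : distToSet G u {z | z ∈ p.support} + distToSet G v {z | z ∈ p.support} ≤ 3) :
    D ≤ 9 := by
  obtain ⟨i, hi, ei⟩ := distToSet_aux G p u
  obtain ⟨j, hj, ej⟩ := distToSet_aux G p v
  obtain ⟨k, hk, ek⟩ := distToSet_aux G p w
  have h1 := dist_pair_aux G hconn p u v i j hi hj
  have h2 := dist_pair_aux G hconn p u w i k hi hk
  have h3 := dist_pair_aux G hconn p v w j k hj hk
  have h4 := hdiam a b
  omega
end
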